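/- arXiv:1310.7270 — 2 statements merged into one kernel-verified Lean document; each statement's English description precedes it below -/
import Mathlib

section
/- Uniqueness of the Stieltjes kernel: fix τ ∈ ℕ₀, c > 0, a constant λ̄ ≥ 0, a probability measure F on ℝ^m, and a jointly continuous function h : ℝ^m × [0,2π] → [0, λ̄²]. Suppose K₁(z,ν) and K₂(z,ν) are both analytic in z ∈ ℂ⁺, continuous in ν ∈ [0,2π], are for each ν Stieltjes transforms of measures with mass at most λ̄², and both satisfy K_j(z,ν) = ∫ [ (2π)^{-1} ∫₀^{2π} cos(τν′) h(λ,ν′) / (1 + c cos(τν′) K_j(z,ν′)) dν′ − z ]^{-1} h(λ,ν) dF(λ) for all z ∈ ℂ⁺. Then K₁ = K₂ on ℂ⁺ × [0,2π]. -/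
open Complex MeasureTheory Real Set
open scoped BigOperators

/-- `K` is, in each variable, a nice Stieltjes kernel: analytic in `z` on the
upper half plane, continuous in `ν` on `[0,2π]`, and for each fixed `ν` the
Stieltjes transform of a positive measure with mass at most `λ̄²`. -/
def IsNiceStieltjesKernel (lamBar : ℝ) (K : ℂ → ℝ → ℂ) : Prop :=
  (∀ ν ∈ Icc (0:ℝ) (2 * π), AnalyticOnNhd ℂ (fun z => K z ν) {z : ℂ | 0 < z.im}) ∧
  (∀ z : ℂ, 0 < z.im → ContinuousOn (fun ν => K z ν) (Icc (0:ℝ) (2 * π))) ∧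
  (∀ ν ∈ Icc (0:ℝ) (2 * π), ∃ μ : Measure ℝ, IsFiniteMeasure μ ∧
    μ Set.univ ≤ ENNReal.ofReal (lamBar ^ 2) ∧
    ∀ z : ℂ, 0 < z.im → K z ν = ∫ σ : ℝ, ((σ : ℂ) - z)⁻¹ ∂μ)

/-- `K` solves the self-consistent Stieltjes-kernel equation (2.3) of
Liu–Aue–Paul with lag `τ`, aspect ratio `c`, limiting eigenvalue distribution
`F` and power transfer function `h`. -/
def SolvesKernelEquation (m : ℕ) (τ : ℕ) (c : ℝ)
    (F : Measure (Fin m → ℝ)) (h : (Fin m → ℝ) → ℝ → ℝ) (K : ℂ → ℝ → ℂ) : Prop :=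
  ∀ z : ℂ, 0 < z.im → ∀ ν ∈ Icc (0:ℝ) (2 * π),
    K z ν = ∫ lam : Fin m → ℝ,
      (((2 * π : ℝ) : ℂ)⁻¹ *
        (∫ ν' in (0:ℝ)..(2 * π),
          ((Real.cos (τ * ν') * h lam ν' : ℝ) : ℂ) /
            (1 + (c : ℂ) * ((Real.cos (τ * ν') : ℝ) : ℂ) * K z ν')) - z)⁻¹ *
      ((h lam ν : ℝ) : ℂ) ∂F

/-- The resolvent `(σ - z)⁻¹` at a real point is bounded by `(Im z)⁻¹`. -/
lemma norm_inv_ofReal_sub_le {z : ℂ} (hz : 0 < z.im) (σ : ℝ) :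
    ‖((σ : ℂ) - z)⁻¹‖ ≤ z.im⁻¹ := by
  rw [norm_inv]
  refine inv_anti₀ hz ?_
  have := Complex.abs_im_le_norm ((σ : ℂ) - z)
  simpa [abs_of_pos hz] using this

/-- A nice Stieltjes kernel decays like `λ̄² / Im z`. -/
lemma IsNiceStieltjesKernel.norm_le {lamBar : ℝ} {K : ℂ → ℝ → ℂ}
    (hK : IsNiceStieltjesKernel lamBar K) {z : ℂ} (hz : 0 < z.im) {ν : ℝ}
    (hν : ν ∈ Icc (0:ℝ) (2 * π)) : ‖K z ν‖ ≤ lamBar ^ 2 / z.im := by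
  obtain ⟨μ, hμ, hmass, hrep⟩ := hK.2.2 ν hν
  rw [hrep z hz]
  have hle : ‖∫ σ : ℝ, ((σ : ℂ) - z)⁻¹ ∂μ‖ ≤ z.im⁻¹ * μ.real univ :=
    norm_integral_le_of_norm_le_const (Filter.Eventually.of_forall fun σ =>
      norm_inv_ofReal_sub_le hz σ)
  have hreal : μ.real univ ≤ lamBar ^ 2 :=
    ENNReal.toReal_le_of_le_ofReal (sq_nonneg _) hmass
  calc _ ≤ z.im⁻¹ * μ.real univ := hle
    _ ≤ z.im⁻¹ * lamBar ^ 2 := by gcongr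
    _ = lamBar ^ 2 / z.im := by rw [div_eq_inv_mul]

/-- The averaged symbol inside the resolvent of the kernel equation. -/
noncomputable def averagedSymbol (τ : ℕ) (c : ℝ) (g : ℝ → ℝ) (k : ℝ → ℂ) : ℂ :=
  ((2 * π : ℝ) : ℂ)⁻¹ *
    (∫ ν' in (0:ℝ)..(2 * π),
      ((Real.cos (τ * ν') * g ν' : ℝ) : ℂ) /
        (1 + (c : ℂ) * ((Real.cos (τ * ν') : ℝ) : ℂ) * k ν'))

lemma half_le_norm_one_add {c : ℝ} (hc : 0 < c) (t : ℝ) {w : ℂ} (hw : c * ‖w‖ ≤ 1 / 2) :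
    1 / 2 ≤ ‖1 + (c : ℂ) * ((Real.cos t : ℝ) : ℂ) * w‖ := by
  have h1 : ‖(c : ℂ) * ((Real.cos t : ℝ) : ℂ) * w‖ ≤ 1 / 2 := by
    rw [norm_mul, norm_mul, Complex.norm_real, Complex.norm_real, Real.norm_eq_abs,
      Real.norm_eq_abs, abs_of_pos hc]
    calc c * |Real.cos t| * ‖w‖ ≤ c * 1 * ‖w‖ := by gcongr; exact Real.abs_cos_le_one t
      _ ≤ 1 / 2 := by linarith
  have h2 := norm_sub_le_norm_add (1 : ℂ) ((c : ℂ) * ((Real.cos t : ℝ) : ℂ) * w)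
  rw [norm_one] at h2
  linarith

lemma norm_cos_mul_le {L t x : ℝ} (hx : x ∈ Icc 0 L) :
    ‖((Real.cos t * x : ℝ) : ℂ)‖ ≤ L := by
  rw [Complex.norm_real, Real.norm_eq_abs, abs_mul, abs_of_nonneg hx.1]
  calc |Real.cos t| * x ≤ 1 * x := by
        gcongr
        · exact hx.1
        · exact Real.abs_cos_le_one t
    _ ≤ L := by linarith [hx.2]

lemma norm_symbol_le {c L t x : ℝ} (hc : 0 < c) {w : ℂ} (hw : c * ‖w‖ ≤ 1 / 2)
    (hx : x ∈ Icc 0 L) :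
    ‖((Real.cos t * x : ℝ) : ℂ) / (1 + (c : ℂ) * ((Real.cos t : ℝ) : ℂ) * w)‖ ≤ 2 * L := by
  have h1 := half_le_norm_one_add hc t hw
  have hL : 0 ≤ L := hx.1.trans hx.2
  rw [norm_div, div_le_iff₀ (by linarith)]
  nlinarith [norm_cos_mul_le (t := t) hx]

lemma norm_symbol_sub_le {c L t x M : ℝ} (hc : 0 < c) {w₁ w₂ : ℂ}
    (hw₁ : c * ‖w₁‖ ≤ 1 / 2) (hw₂ : c * ‖w₂‖ ≤ 1 / 2) (hx : x ∈ Icc 0 L)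
    (hM : ‖w₁ - w₂‖ ≤ M) :
    ‖((Real.cos t * x : ℝ) : ℂ) / (1 + (c : ℂ) * ((Real.cos t : ℝ) : ℂ) * w₁) -
      ((Real.cos t * x : ℝ) : ℂ) / (1 + (c : ℂ) * ((Real.cos t : ℝ) : ℂ) * w₂)‖
      ≤ 4 * c * L * M := by
  have h1 := half_le_norm_one_add hc t hw₁
  have h2 := half_le_norm_one_add hc t hw₂
  have hL : 0 ≤ L := hx.1.trans hx.2
  have hM0 : 0 ≤ M := (norm_nonneg _).trans hM
  set d₁ := 1 + (c : ℂ) * ((Real.cos t : ℝ) : ℂ) * w₁ with hd₁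
  set d₂ := 1 + (c : ℂ) * ((Real.cos t : ℝ) : ℂ) * w₂ with hd₂
  have n1 : d₁ ≠ 0 := norm_pos_iff.mp (by linarith)
  have n2 : d₂ ≠ 0 := norm_pos_iff.mp (by linarith)
  rw [div_sub_div _ _ n1 n2, norm_div, norm_mul d₁, div_le_iff₀ (by positivity)]
  have hnum : ((Real.cos t * x : ℝ) : ℂ) * d₂ - d₁ * ((Real.cos t * x : ℝ) : ℂ) =
      ((Real.cos t * x : ℝ) : ℂ) * (((c * Real.cos t : ℝ) : ℂ) * (w₂ - w₁)) := by
    rw [hd₁, hd₂]; push_cast; ring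
  have hcc : ‖((c * Real.cos t : ℝ) : ℂ)‖ ≤ c := by
    rw [Complex.norm_real, Real.norm_eq_abs, abs_mul, abs_of_pos hc]
    nlinarith [Real.abs_cos_le_one t]
  have hprod : 1 / 4 ≤ ‖d₁‖ * ‖d₂‖ := by nlinarith
  rw [hnum, norm_mul, norm_mul, norm_sub_rev w₂ w₁]
  calc _ ≤ L * (c * M) := by
        gcongr
        exact norm_cos_mul_le hx
    _ ≤ 4 * c * L * M * (‖d₁‖ * ‖d₂‖) := by
        have : 0 ≤ c * L * M := by positivity
        nlinarith

lemma continuousOn_symbol {τ : ℕ} {c : ℝ} (hc : 0 < c) {g : ℝ → ℝ} {k : ℝ → ℂ}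
    (hg : ContinuousOn g (Icc (0:ℝ) (2 * π))) (hk : ContinuousOn k (Icc (0:ℝ) (2 * π)))
    (hsmall : ∀ ν ∈ Icc (0:ℝ) (2 * π), c * ‖k ν‖ ≤ 1 / 2) :
    ContinuousOn (fun ν' => ((Real.cos (τ * ν') * g ν' : ℝ) : ℂ) /
      (1 + (c : ℂ) * ((Real.cos (τ * ν') : ℝ) : ℂ) * k ν')) (Icc (0:ℝ) (2 * π)) := by
  have hcos : ContinuousOn (fun ν' : ℝ => Real.cos (τ * ν')) (Icc (0:ℝ) (2 * π)) := by
    fun_prop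
  refine ContinuousOn.div (Complex.continuous_ofReal.comp_continuousOn (hcos.mul hg)) ?_ ?_
  · exact continuousOn_const.add ((continuousOn_const.mul
      (Complex.continuous_ofReal.comp_continuousOn hcos)).mul hk)
  · intro ν hν
    have := half_le_norm_one_add hc (τ * ν) (hsmall ν hν)
    exact norm_pos_iff.mp (by linarith)

lemma norm_inv_two_pi_mul_integral_le {f : ℝ → ℂ} {C : ℝ}
    (hf : ∀ ν ∈ Icc (0:ℝ) (2 * π), ‖f ν‖ ≤ C) :
    ‖((2 * π : ℝ) : ℂ)⁻¹ * ∫ ν in (0:ℝ)..(2 * π), f ν‖ ≤ C := by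
  have hpi : 0 < 2 * π := Real.two_pi_pos
  have h1 : ‖∫ ν in (0:ℝ)..(2 * π), f ν‖ ≤ C * |2 * π - 0| := by
    refine intervalIntegral.norm_integral_le_of_norm_le_const fun ν hν => hf ν ?_
    rw [uIoc_of_le hpi.le] at hν
    exact Ioc_subset_Icc_self hν
  rw [sub_zero, abs_of_pos hpi] at h1
  rw [norm_mul, norm_inv, Complex.norm_real, Real.norm_eq_abs, abs_of_pos hpi,
    inv_mul_le_iff₀ hpi]
  linarith

lemma norm_averagedSymbol_le {τ : ℕ} {c L : ℝ} (hc : 0 < c) {g : ℝ → ℝ} {k : ℝ → ℂ}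
    (hg : ∀ ν ∈ Icc (0:ℝ) (2 * π), g ν ∈ Icc 0 L)
    (hsmall : ∀ ν ∈ Icc (0:ℝ) (2 * π), c * ‖k ν‖ ≤ 1 / 2) :
    ‖averagedSymbol τ c g k‖ ≤ 2 * L :=
  norm_inv_two_pi_mul_integral_le fun ν hν => norm_symbol_le hc (hsmall ν hν) (hg ν hν)

lemma norm_averagedSymbol_sub_le {τ : ℕ} {c L M : ℝ} (hc : 0 < c) {g : ℝ → ℝ}
    {k₁ k₂ : ℝ → ℂ} (hgc : ContinuousOn g (Icc (0:ℝ) (2 * π)))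
    (hg : ∀ ν ∈ Icc (0:ℝ) (2 * π), g ν ∈ Icc 0 L)
    (hk₁ : ContinuousOn k₁ (Icc (0:ℝ) (2 * π))) (hk₂ : ContinuousOn k₂ (Icc (0:ℝ) (2 * π)))
    (hs₁ : ∀ ν ∈ Icc (0:ℝ) (2 * π), c * ‖k₁ ν‖ ≤ 1 / 2)
    (hs₂ : ∀ ν ∈ Icc (0:ℝ) (2 * π), c * ‖k₂ ν‖ ≤ 1 / 2)
    (hM : ∀ ν ∈ Icc (0:ℝ) (2 * π), ‖k₁ ν - k₂ ν‖ ≤ M) :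
    ‖averagedSymbol τ c g k₁ - averagedSymbol τ c g k₂‖ ≤ 4 * c * L * M := by
  rw [averagedSymbol, averagedSymbol, ← mul_sub, ← intervalIntegral.integral_sub
    ((continuousOn_symbol hc hgc hk₁ hs₁).intervalIntegrable_of_Icc Real.two_pi_pos.le)
    ((continuousOn_symbol hc hgc hk₂ hs₂).intervalIntegrable_of_Icc Real.two_pi_pos.le)]
  exact norm_inv_two_pi_mul_integral_le fun ν hν =>
    norm_symbol_sub_le hc (hs₁ ν hν) (hs₂ ν hν) (hg ν hν) (hM ν hν)

lemma continuous_averagedSymbol {E : Type*} [TopologicalSpace E] [FirstCountableTopology E]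
    {τ : ℕ} {c L : ℝ} (hc : 0 < c) {h : E → ℝ → ℝ}
    (hcont : ContinuousOn (fun q : E × ℝ => h q.1 q.2) (univ ×ˢ Icc (0:ℝ) (2 * π)))
    (hrange : ∀ x : E, ∀ ν ∈ Icc (0:ℝ) (2 * π), h x ν ∈ Icc 0 L)
    {k : ℝ → ℂ} (hk : ContinuousOn k (Icc (0:ℝ) (2 * π)))
    (hsmall : ∀ ν ∈ Icc (0:ℝ) (2 * π), c * ‖k ν‖ ≤ 1 / 2) :
    Continuous fun x => averagedSymbol τ c (h x) k := by
  have hsub : uIoc (0:ℝ) (2 * π) ⊆ Icc 0 (2 * π) := by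
    rw [uIoc_of_le Real.two_pi_pos.le]; exact Ioc_subset_Icc_self
  refine continuous_const.mul (intervalIntegral.continuous_of_dominated_interval
    (bound := fun _ => 2 * L) (fun x => ?_) (fun x => ?_) intervalIntegrable_const ?_)
  · have hx : ContinuousOn (h x) (Icc (0:ℝ) (2 * π)) :=
      hcont.comp (f := fun ν => (x, ν)) (by fun_prop) fun ν hν => ⟨mem_univ _, hν⟩
    exact ((continuousOn_symbol hc hx hk hsmall).mono hsub).aestronglyMeasurable
      measurableSet_uIoc
  · exact Filter.Eventually.of_forall fun ν hν =>
      norm_symbol_le hc (hsmall ν (hsub hν)) (hrange x ν (hsub hν))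
  · refine Filter.Eventually.of_forall fun ν hν => ?_
    have hx : Continuous fun x => h x ν :=
      hcont.comp_continuous (f := fun x => (x, ν)) (by fun_prop)
        fun x => ⟨mem_univ _, hsub hν⟩
    exact (Complex.continuous_ofReal.comp (continuous_const.mul hx)).div_const _

/-- High in the upper half plane, the kernel equation halves the distance between solutions. -/
lemma SolvesKernelEquation.norm_sub_le_half {m τ : ℕ} {c L M : ℝ} (hc : 0 < c)
    {F : Measure (Fin m → ℝ)} [IsProbabilityMeasure F] {h : (Fin m → ℝ) → ℝ → ℝ}
    (hcont : ContinuousOn (fun q : (Fin m → ℝ) × ℝ => h q.1 q.2)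
      (univ ×ˢ Icc (0:ℝ) (2 * π)))
    (hrange : ∀ lam : Fin m → ℝ, ∀ ν ∈ Icc (0:ℝ) (2 * π), h lam ν ∈ Icc 0 L)
    {K₁ K₂ : ℂ → ℝ → ℂ}
    (he₁ : SolvesKernelEquation m τ c F h K₁) (he₂ : SolvesKernelEquation m τ c F h K₂)
    {z : ℂ} (hz : 0 < z.im) (hzL : 2 * L + 1 + 8 * c * L ^ 2 ≤ z.im)
    (hk₁ : ContinuousOn (K₁ z) (Icc (0:ℝ) (2 * π)))
    (hk₂ : ContinuousOn (K₂ z) (Icc (0:ℝ) (2 * π)))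
    (hs₁ : ∀ ν ∈ Icc (0:ℝ) (2 * π), c * ‖K₁ z ν‖ ≤ 1 / 2)
    (hs₂ : ∀ ν ∈ Icc (0:ℝ) (2 * π), c * ‖K₂ z ν‖ ≤ 1 / 2)
    (hM : ∀ ν ∈ Icc (0:ℝ) (2 * π), ‖K₁ z ν - K₂ z ν‖ ≤ M) :
    ∀ ν ∈ Icc (0:ℝ) (2 * π), ‖K₁ z ν - K₂ z ν‖ ≤ M / 2 := by
  intro ν hν
  have hM0 : 0 ≤ M := (norm_nonneg _).trans (hM ν hν)
  have hgap : ∀ {w : ℂ}, ‖w‖ ≤ 2 * L → 1 + 8 * c * L ^ 2 ≤ ‖w - z‖ := by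
    intro w hw
    have h1 := norm_sub_norm_le z w
    have h2 := (le_abs_self _).trans (Complex.abs_im_le_norm z)
    rw [norm_sub_rev] at h1
    linarith
  have hT : 0 ≤ 8 * c * L ^ 2 := by positivity
  have hhν : Continuous fun lam => h lam ν :=
    hcont.comp_continuous (f := fun lam => (lam, ν)) (by fun_prop)
      fun lam => ⟨mem_univ _, hν⟩
  have hnormh : ∀ lam, ‖((h lam ν : ℝ) : ℂ)‖ ≤ L := fun lam => by
    rw [Complex.norm_real, Real.norm_eq_abs, abs_of_nonneg (hrange lam ν hν).1]
    exact (hrange lam ν hν).2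
  have hint : ∀ {k : ℝ → ℂ}, ContinuousOn k (Icc (0:ℝ) (2 * π)) →
      (∀ ν ∈ Icc (0:ℝ) (2 * π), c * ‖k ν‖ ≤ 1 / 2) →
      Integrable (fun lam => (averagedSymbol τ c (h lam) k - z)⁻¹ * ((h lam ν : ℝ) : ℂ)) F := by
    intro k hk hs
    have hlow := fun lam => hgap (norm_averagedSymbol_le (τ := τ) hc (hrange lam) hs)
    refine Integrable.of_bound (C := L) (Continuous.aestronglyMeasurable ?_)
      (Filter.Eventually.of_forall fun lam => ?_)
    · have hne : ∀ lam, averagedSymbol τ c (h lam) k - z ≠ 0 := fun lam =>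
        norm_pos_iff.mp (by linarith [hlow lam])
      exact (((continuous_averagedSymbol hc hcont hrange hk hs).sub
        continuous_const).inv₀ hne).mul (Complex.continuous_ofReal.comp hhν)
    · rw [norm_mul, norm_inv]
      have : ‖averagedSymbol τ c (h lam) k - z‖⁻¹ ≤ 1 :=
        inv_le_one_of_one_le₀ (by linarith [hlow lam])
      exact (mul_le_mul this (hnormh lam) (norm_nonneg _) zero_le_one).trans (one_mul L).le
  have e₁ : K₁ z ν = ∫ lam, (averagedSymbol τ c (h lam) (K₁ z) - z)⁻¹ *
      ((h lam ν : ℝ) : ℂ) ∂F := he₁ z hz ν hν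
  have e₂ : K₂ z ν = ∫ lam, (averagedSymbol τ c (h lam) (K₂ z) - z)⁻¹ *
      ((h lam ν : ℝ) : ℂ) ∂F := he₂ z hz ν hν
  rw [e₁, e₂, ← integral_sub (hint hk₁ hs₁) (hint hk₂ hs₂)]
  refine (norm_integral_le_of_norm_le_const (C := M / 2)
    (Filter.Eventually.of_forall fun lam => ?_)).trans (by simp)
  have hgc : ContinuousOn (h lam) (Icc (0:ℝ) (2 * π)) :=
    hcont.comp (f := fun ν => (lam, ν)) (by fun_prop) fun ν hν => ⟨mem_univ _, hν⟩
  have l₁ := hgap (norm_averagedSymbol_le (τ := τ) hc (hrange lam) hs₁)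
  have l₂ := hgap (norm_averagedSymbol_le (τ := τ) hc (hrange lam) hs₂)
  have hd := norm_averagedSymbol_sub_le (τ := τ) hc hgc (hrange lam) hk₁ hk₂ hs₁ hs₂ hM
  rw [← sub_mul]
  set a := averagedSymbol τ c (h lam) (K₁ z)
  set b := averagedSymbol τ c (h lam) (K₂ z)
  have na : a - z ≠ 0 := norm_pos_iff.mp (by linarith)
  have nb : b - z ≠ 0 := norm_pos_iff.mp (by linarith)
  have hL : 0 ≤ L := (norm_nonneg _).trans (hnormh lam)
  rw [inv_sub_inv na nb, div_mul_eq_mul_div, norm_div, norm_mul, norm_mul,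
    div_le_iff₀ (by positivity), show b - z - (a - z) = b - a by ring, norm_sub_rev b a]
  have hden : 1 + 8 * c * L ^ 2 ≤ ‖a - z‖ * ‖b - z‖ := by nlinarith
  calc ‖a - b‖ * ‖((h lam ν : ℝ) : ℂ)‖ ≤ (4 * c * L * M) * L := by
        gcongr
        exact hnormh lam
    _ = M / 2 * (8 * c * L ^ 2) := by ring
    _ ≤ M / 2 * (‖a - z‖ * ‖b - z‖) :=
        mul_le_mul_of_nonneg_left (by linarith) (by linarith)

/-- Uniqueness of the Stieltjes kernel: two nice Stieltjes-kernel solutions of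
the self-consistent equation must coincide on `ℂ⁺ × [0,2π]`. -/
theorem stieltjes_kernel_unique
    (m τ : ℕ) (c lamBar : ℝ) (hc : 0 < c) (hlam : 0 ≤ lamBar)
    (F : Measure (Fin m → ℝ)) [IsProbabilityMeasure F]
    (h : (Fin m → ℝ) → ℝ → ℝ)
    (hcont : ContinuousOn (fun q : (Fin m → ℝ) × ℝ => h q.1 q.2)
      (Set.univ ×ˢ Icc (0:ℝ) (2 * π)))
    (hrange : ∀ lam : Fin m → ℝ, ∀ ν ∈ Icc (0:ℝ) (2 * π),
      h lam ν ∈ Icc (0:ℝ) (lamBar ^ 2))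
    (K₁ K₂ : ℂ → ℝ → ℂ)
    (h₁ : IsNiceStieltjesKernel lamBar K₁) (h₂ : IsNiceStieltjesKernel lamBar K₂)
    (he₁ : SolvesKernelEquation m τ c F h K₁)
    (he₂ : SolvesKernelEquation m τ c F h K₂) :
    ∀ z : ℂ, 0 < z.im → ∀ ν ∈ Icc (0:ℝ) (2 * π), K₁ z ν = K₂ z ν := by
  set L := lamBar ^ 2 with hLdef
  have hL : 0 ≤ L := sq_nonneg _
  set V := 2 * L + 1 + 8 * c * L ^ 2 + 2 * c * L with hV
  have hVpos : 0 < V := by positivity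
  have hhigh : ∀ z : ℂ, V ≤ z.im → ∀ ν ∈ Icc (0:ℝ) (2 * π), K₁ z ν = K₂ z ν := by
    intro z hzV
    have hz : 0 < z.im := hVpos.trans_le hzV
    have hsmall : ∀ {K : ℂ → ℝ → ℂ}, IsNiceStieltjesKernel lamBar K →
        ∀ ν ∈ Icc (0:ℝ) (2 * π), c * ‖K z ν‖ ≤ 1 / 2 := by
      intro K hK ν hν
      have hb : ‖K z ν‖ * z.im ≤ L := (le_div_iff₀ hz).mp (hK.norm_le hz hν)
      have h2 : 2 * c * L ≤ z.im := by
        have : 0 ≤ 2 * L + 1 + 8 * c * L ^ 2 := by positivity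
        linarith
      refine le_of_mul_le_mul_right ?_ hz
      nlinarith
    have hiter : ∀ n : ℕ, ∀ ν ∈ Icc (0:ℝ) (2 * π),
        ‖K₁ z ν - K₂ z ν‖ ≤ (L / z.im + L / z.im) * (1 / 2) ^ n := by
      intro n
      induction n with
      | zero =>
        intro ν hν
        simpa using (norm_sub_le _ _).trans
          (add_le_add (h₁.norm_le hz hν) (h₂.norm_le hz hν))
      | succ n ih =>
        intro ν hν
        have hle : 2 * L + 1 + 8 * c * L ^ 2 ≤ z.im := by
          have : 0 ≤ 2 * c * L := by positivity
          linarith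
        have := he₁.norm_sub_le_half hc hcont hrange he₂ hz hle (h₁.2.1 z hz) (h₂.2.1 z hz)
          (hsmall h₁) (hsmall h₂) ih ν hν
        rw [pow_succ]
        linarith
    intro ν hν
    have hlim : Filter.Tendsto (fun n : ℕ => (L / z.im + L / z.im) * (1 / 2 : ℝ) ^ n)
        Filter.atTop (nhds 0) := by
      simpa using (tendsto_pow_atTop_nhds_zero_of_lt_one (r := (1 / 2 : ℝ)) (by norm_num)
        (by norm_num)).const_mul (L / z.im + L / z.im)
    have h0 := ge_of_tendsto' hlim fun n => hiter n ν hν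
    exact sub_eq_zero.mp (norm_le_zero_iff.mp h0)
  intro z hz ν hν
  have hconn : IsPreconnected {z : ℂ | 0 < z.im} :=
    (convex_halfSpace_im_gt 0).isPreconnected
  have hpt : (V + 1 : ℝ) * Complex.I ∈ {z : ℂ | 0 < z.im} := by
    simp only [mem_ofPred_eq, Complex.im_ofReal_mul, Complex.I_im]
    linarith
  refine (h₁.1 ν hν).eqOn_of_preconnected_of_eventuallyEq (h₂.1 ν hν) hconn hpt ?_ hz
  have hopen : IsOpen {z : ℂ | V < z.im} := isOpen_lt continuous_const Complex.continuous_im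
  filter_upwards [hopen.mem_nhds (x := (V + 1 : ℝ) * Complex.I) (by
    simp only [mem_ofPred_eq, Complex.im_ofReal_mul, Complex.I_im]
    linarith)] with w hw
  exact hhigh w (le_of_lt hw) ν hν
end

section
/- Rank bound for the symmetrized autocovariance approximation: let X and X₁ be p×n matrices differing in at most one column, L the lag matrix, L̃ the circulant shift, and define C_τ = (2n)^{-1}X(L^τ + (L^*)^τ)X^* and C̃_τ = (2n)^{-1}X₁(L̃^τ + (L̃^*)^τ)X₁^*. Then rank(C_τ − C̃_τ) ≤ 2(1 + τ). -/
open Complex Matrix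

/-- The n×n nilpotent lag matrix: columns `[0, e_1, ..., e_{n-1}]`. -/
noncomputable def lagMatrix (n : ℕ) : Matrix (Fin n) (Fin n) ℂ :=
  Matrix.of fun i j => if i.val + 1 = j.val then 1 else 0

/-- The n×n circulant shift matrix: columns `[e_n, e_1, ..., e_{n-1}]`. -/
noncomputable def circShift (n : ℕ) : Matrix (Fin n) (Fin n) ℂ :=
  Matrix.of fun i j => if (i.val + 1) % n = j.val then 1 else 0

namespace Matrix

variable {m n : Type*} [Fintype n]

lemma rank_add_le_rank_add_rank {K : Type*} [Field K] (A B : Matrix m n K) :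
    (A + B).rank ≤ A.rank + B.rank := by
  rw [Matrix.rank, mulVecLin_add]
  have hle : LinearMap.range (A.mulVecLin + B.mulVecLin) ≤
      LinearMap.range A.mulVecLin ⊔ LinearMap.range B.mulVecLin := by
    rintro _ ⟨v, rfl⟩
    exact Submodule.add_mem_sup ⟨v, rfl⟩ ⟨v, rfl⟩
  exact (Submodule.finrank_mono hle).trans (Submodule.finrank_add_le_finrank_add_finrank _ _)

lemma rank_smul_le_rank {K : Type*} [Field K] [DecidableEq n] (c : K) (A : Matrix m n K) :
    (c • A).rank ≤ A.rank := by
  have h : c • A = A * (c • (1 : Matrix n n K)) := by simp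
  rw [h]
  exact rank_mul_le_left _ _

/-- A telescoping bound for the rank of a difference of powers. -/
lemma rank_pow_sub_pow_le {K : Type*} [Field K] [DecidableEq n] (A B : Matrix n n K) (k : ℕ) :
    (A ^ k - B ^ k).rank ≤ k * (A - B).rank := by
  induction k with
  | zero => simp
  | succ k ih =>
    have h : A ^ (k + 1) - B ^ (k + 1) = (A ^ k - B ^ k) * B + A ^ k * (A - B) := by
      rw [pow_succ, pow_succ]; noncomm_ring
    rw [h, add_mul, one_mul]
    exact (rank_add_le_rank_add_rank _ _).trans
      (add_le_add ((rank_mul_le_left _ _).trans ih) (rank_mul_le_right _ _))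

/-- A matrix supported on a single column has rank at most one. -/
lemma rank_le_one_of_forall_ne {K : Type*} [Field K] (A : Matrix m n K) (j₀ : n)
    (h : ∀ j, j ≠ j₀ → ∀ i, A i j = 0) : A.rank ≤ 1 := by
  classical
  have hA : A = vecMulVec (fun i => A i j₀) (Pi.single j₀ 1) := by
    ext i j
    by_cases hj : j = j₀
    · subst hj; simp [vecMulVec_apply]
    · simp [vecMulVec_apply, hj, h j hj i]
  rw [hA]
  exact rank_vecMulVec_le _ _

open scoped ComplexOrder in
lemma rank_conjTranspose_complex [Fintype m] (A : Matrix m n ℂ) : Aᴴ.rank = A.rank :=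
  rank_conjTranspose A

end Matrix

lemma rank_lagMatrix_sub_circShift_le (n : ℕ) : (lagMatrix n - circShift n).rank ≤ 1 := by
  rcases Nat.eq_zero_or_pos n with rfl | hn
  · exact (rank_le_width _).trans zero_le_one
  refine rank_le_one_of_forall_ne _ ⟨0, hn⟩ fun j hj i => ?_
  have hj' : j.val ≠ 0 := fun h => hj (Fin.ext h)
  have hiff : (i.val + 1) % n = j.val ↔ i.val + 1 = j.val := by
    rcases Nat.lt_or_ge (i.val + 1) n with hi | hi
    · rw [Nat.mod_eq_of_lt hi]
    · have : i.val + 1 = n := le_antisymm i.isLt hi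
      rw [this, Nat.mod_self]
      have := j.isLt
      omega
  simp [lagMatrix, circShift, hiff]

/-- The symmetrized powers of the lag matrix and of the circulant shift differ by rank at most
`2 * τ`. -/
lemma rank_symmetrized_pow_sub_le (n τ : ℕ) :
    ((lagMatrix n ^ τ + (lagMatrix n)ᴴ ^ τ) -
      (circShift n ^ τ + (circShift n)ᴴ ^ τ)).rank ≤ 2 * τ := by
  have h : (lagMatrix n ^ τ + (lagMatrix n)ᴴ ^ τ) - (circShift n ^ τ + (circShift n)ᴴ ^ τ)
      = (lagMatrix n ^ τ - circShift n ^ τ) + (lagMatrix n ^ τ - circShift n ^ τ)ᴴ := by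
    rw [conjTranspose_sub, conjTranspose_pow, conjTranspose_pow]; abel
  have hτ : (lagMatrix n ^ τ - circShift n ^ τ).rank ≤ τ :=
    (rank_pow_sub_pow_le _ _ τ).trans
      (mul_le_of_le_one_right (Nat.zero_le τ) (rank_lagMatrix_sub_circShift_le n))
  have hadd := rank_add_le_rank_add_rank (lagMatrix n ^ τ - circShift n ^ τ)
    (lagMatrix n ^ τ - circShift n ^ τ)ᴴ
  rw [rank_conjTranspose_complex] at hadd
  rw [h]
  omega

/-- Rank bound for the symmetrized autocovariance approximation: if `X` and `X₁`
differ in at most one column, then with `C_τ = (2n)⁻¹ X (L^τ + (L^*)^τ) X^*` and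
`C̃_τ = (2n)⁻¹ X₁ (L̃^τ + (L̃^*)^τ) X₁^*`, `rank(C_τ − C̃_τ) ≤ 2(1 + τ)`. -/
theorem rank_symmetrized_autocov_approx
    (p n : ℕ) (hn : 0 < n) (τ : ℕ)
    (X X₁ : Matrix (Fin p) (Fin n) ℂ)
    (hcol : ∃ j₀ : Fin n, ∀ j : Fin n, j ≠ j₀ → ∀ i : Fin p, X i j = X₁ i j) :
    (((2 * n : ℂ))⁻¹ • (X * (lagMatrix n ^ τ + (lagMatrix n)ᴴ ^ τ) * Xᴴ)
      - ((2 * n : ℂ))⁻¹ • (X₁ * (circShift n ^ τ + (circShift n)ᴴ ^ τ) * X₁ᴴ)).rank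
      ≤ 2 * (1 + τ) := by
  obtain ⟨j₀, hj₀⟩ := hcol
  have hdiff : (X - X₁).rank ≤ 1 :=
    rank_le_one_of_forall_ne _ j₀ fun j hj i => by simp [hj₀ j hj i]
  have hAB := rank_symmetrized_pow_sub_le n τ
  set A := lagMatrix n ^ τ + (lagMatrix n)ᴴ ^ τ
  set B := circShift n ^ τ + (circShift n)ᴴ ^ τ
  have hsplit : X * A * Xᴴ - X₁ * B * X₁ᴴ
      = (X - X₁) * (A * Xᴴ) + X₁ * A * (X - X₁)ᴴ + X₁ * (A - B) * X₁ᴴ := by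
    simp only [conjTranspose_sub, Matrix.sub_mul, Matrix.mul_sub, Matrix.mul_assoc]
    abel
  rw [← smul_sub, hsplit]
  have h₁ : ((X - X₁) * (A * Xᴴ)).rank ≤ 1 := (rank_mul_le_left _ _).trans hdiff
  have h₂ : (X₁ * A * (X - X₁)ᴴ).rank ≤ 1 :=
    (rank_mul_le_right _ _).trans ((rank_conjTranspose_complex _).trans_le hdiff)
  have h₃ : (X₁ * (A - B) * X₁ᴴ).rank ≤ 2 * τ :=
    (rank_mul_le_left _ _).trans ((rank_mul_le_right _ _).trans hAB)
  calc _ ≤ _ := rank_smul_le_rank _ _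
    _ ≤ _ := rank_add_le_rank_add_rank _ _
    _ ≤ (1 + 1) + 2 * τ :=
      add_le_add ((rank_add_le_rank_add_rank _ _).trans (add_le_add h₁ h₂)) h₃
    _ = 2 * (1 + τ) := by ring
end
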